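/- arXiv:1911.05315 — 2 statements merged into one kernel-verified Lean document; each statement's English description precedes it below -/
import Mathlib

section
/- If f(z) = Σ_{n=0}^∞ a_n z^n is analytic in the open unit disk 𝔻 with |f(z)| ≤ 1 for all z ∈ 𝔻, then for every r with 0 ≤ r ≤ 1/(2+|a_0|) one has Σ_{n=0}^∞ |a_n| r^n + (1/(1+|a_0|) + r/(1-r)) · Σ_{n=1}^∞ |a_n|² r^{2n} ≤ 1. -/
open Complex ComplexConjugate in
theorem integral_exp_int_mul (k : ℤ) :
    ∫ θ in (0 : ℝ)..2 * Real.pi, exp (k * (θ * I)) = if k = 0 then (2 * Real.pi : ℂ) else 0 := by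
  split_ifs with hk
  · simp [hk]
  · have hc : (k : ℂ) * I ≠ 0 := mul_ne_zero (by exact_mod_cast hk) I_ne_zero
    have h := integral_exp_mul_complex (a := 0) (b := 2 * Real.pi) hc
    have h2 : exp ((k : ℂ) * I * ((2 * Real.pi : ℝ) : ℂ)) = 1 := by
      rw [← exp_int_mul_two_pi_mul_I k]
      congr 1
      push_cast
      ring
    rw [h2] at h
    simp only [ofReal_zero, mul_zero, exp_zero, sub_self, zero_div] at h
    rw [← h]
    congr 1
    ext θ
    congr 1
    ring

theorem norm_mul_exp_mul_I {ρ : ℝ} (hρ : 0 ≤ ρ) (θ : ℝ) :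
    ‖(ρ : ℂ) * Complex.exp (θ * Complex.I)‖ = ρ := by
  rw [norm_mul, Complex.norm_exp_ofReal_mul_I, mul_one, Complex.norm_real, Real.norm_of_nonneg hρ]

section PowerSeries

variable {f : ℂ → ℂ} {a : ℕ → ℂ}
  (hf : ∀ z : ℂ, ‖z‖ < 1 → HasSum (fun n : ℕ => a n * z ^ n) (f z))
include hf

theorem summable_norm_coeff_mul_pow {ρ : ℝ} (hρ0 : 0 ≤ ρ) (hρ1 : ρ < 1) :
    Summable (fun n : ℕ => ‖a n‖ * ρ ^ n) := by
  have h := (hf ρ (by rwa [Complex.norm_real, Real.norm_of_nonneg hρ0])).summable.norm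
  simpa [abs_of_nonneg hρ0] using h

open Complex in
theorem continuous_comp_circle {ρ : ℝ} (hρ0 : 0 ≤ ρ) (hρ1 : ρ < 1) :
    Continuous (fun θ : ℝ => f (ρ * exp (θ * I))) := by
  have h : (fun θ : ℝ => f (ρ * exp (θ * I))) =
      fun θ : ℝ => ∑' n : ℕ, a n * (ρ * exp (θ * I)) ^ n := by
    ext θ
    exact (hf _ (by rwa [norm_mul_exp_mul_I hρ0])).tsum_eq.symm
  rw [h]
  refine continuous_tsum (fun n => by fun_prop) (summable_norm_coeff_mul_pow hf hρ0 hρ1) ?_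
  intro n θ
  rw [norm_mul, norm_pow, norm_mul_exp_mul_I hρ0]

open Complex in
theorem integral_circle_mul_exp {ρ : ℝ} (hρ0 : 0 ≤ ρ) (hρ1 : ρ < 1) (i j : ℕ) :
    ∫ θ in (0 : ℝ)..2 * Real.pi,
        f (ρ * exp (θ * I)) * (exp (j * (θ * I)) * exp (-(i * (θ * I)))) =
      2 * Real.pi * if j ≤ i then a (i - j) * (ρ : ℂ) ^ (i - j) else 0 := by
  have key : HasSum (fun n : ℕ => ∫ θ in (0 : ℝ)..2 * Real.pi,
        (a n * (ρ * exp (θ * I)) ^ n) * (exp (j * (θ * I)) * exp (-(i * (θ * I)))))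
      (∫ θ in (0 : ℝ)..2 * Real.pi,
        f (ρ * exp (θ * I)) * (exp (j * (θ * I)) * exp (-(i * (θ * I))))) := by
    refine intervalIntegral.hasSum_integral_of_dominated_convergence
      (fun n _ => ‖a n‖ * ρ ^ n) ?_ ?_ ?_ ?_ ?_
    · intro n
      exact Continuous.aestronglyMeasurable (by fun_prop)
    · intro n
      refine Filter.Eventually.of_forall fun θ _ => le_of_eq ?_
      have h1 : ‖exp (j * (θ * I))‖ = 1 := by
        rw [exp_nat_mul, norm_pow, norm_exp_ofReal_mul_I, one_pow]
      have h2 : ‖exp (-(i * (θ * I)))‖ = 1 := by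
        rw [Complex.exp_neg, norm_inv, exp_nat_mul, norm_pow, norm_exp_ofReal_mul_I, one_pow,
          inv_one]
      rw [norm_mul, norm_mul, norm_mul, h1, h2, norm_pow, norm_mul_exp_mul_I hρ0, mul_one, mul_one]
    · exact Filter.Eventually.of_forall fun θ _ => summable_norm_coeff_mul_pow hf hρ0 hρ1
    · exact intervalIntegrable_const
    · refine Filter.Eventually.of_forall fun θ _ => ?_
      exact (hf _ (by rwa [norm_mul_exp_mul_I hρ0])).mul_right _
  have hterm : ∀ n : ℕ, ∫ θ in (0 : ℝ)..2 * Real.pi,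
        (a n * (ρ * exp (θ * I)) ^ n) * (exp (j * (θ * I)) * exp (-(i * (θ * I)))) =
      if n + j = i then 2 * Real.pi * (a n * (ρ : ℂ) ^ n) else 0 := by
    intro n
    have h : ∀ θ : ℝ, (a n * (ρ * exp (θ * I)) ^ n) * (exp (j * (θ * I)) * exp (-(i * (θ * I)))) =
        (a n * (ρ : ℂ) ^ n) * exp (((n + j - i : ℤ) : ℂ) * (θ * I)) := by
      intro θ
      rw [mul_pow, ← exp_nat_mul]
      have : exp (((n + j - i : ℤ) : ℂ) * (θ * I)) =
          exp (n * (θ * I)) * (exp (j * (θ * I)) * exp (-(i * (θ * I)))) := by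
        rw [← exp_add, ← exp_add]
        congr 1
        push_cast
        ring
      rw [this]
      ring
    simp_rw [h]
    rw [intervalIntegral.integral_const_mul, integral_exp_int_mul]
    have h0 : ((n : ℤ) + j - i = 0) ↔ n + j = i := by omega
    simp only [h0]
    split_ifs
    · ring
    · simp
  simp_rw [hterm] at key
  refine key.unique ?_
  split_ifs with hij
  · convert hasSum_ite_eq (i - j) (2 * Real.pi * (a (i - j) * (ρ : ℂ) ^ (i - j))) using 2 with n
    have : n + j = i ↔ n = i - j := by omega
    simp only [this]
    split_ifs with h
    · rw [h]
    · rfl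
  · rw [mul_zero]
    convert hasSum_zero using 2 with n
    rw [if_neg (by omega)]

open Complex in
theorem integral_circle_mul_sum_mul_sum {ι κ : Type*} [Fintype ι] [Fintype κ]
    {ρ : ℝ} (hρ0 : 0 ≤ ρ) (hρ1 : ρ < 1) (d : ι → ℕ) (e : κ → ℕ) (x : ι → ℂ) (y : κ → ℂ) :
    ∫ θ in (0 : ℝ)..2 * Real.pi,
        f (ρ * exp (θ * I)) *
          ((∑ s, x s * exp (d s * (θ * I))) * ∑ t, y t * exp (-(e t * (θ * I)))) =
      2 * Real.pi * ∑ s, ∑ t, x s * y t *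
        if d s ≤ e t then a (e t - d s) * (ρ : ℂ) ^ (e t - d s) else 0 := by
  have hterm : ∀ s t, Continuous fun θ : ℝ => x s * y t *
      (f (ρ * exp (θ * I)) * (exp (d s * (θ * I)) * exp (-(e t * (θ * I))))) := fun s t =>
    continuous_const.mul ((continuous_comp_circle hf hρ0 hρ1).mul (by fun_prop))
  have h : ∀ θ : ℝ, f (ρ * exp (θ * I)) *
          ((∑ s, x s * exp (d s * (θ * I))) * ∑ t, y t * exp (-(e t * (θ * I)))) =
      ∑ s, ∑ t, x s * y t *
        (f (ρ * exp (θ * I)) * (exp (d s * (θ * I)) * exp (-(e t * (θ * I))))) := by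
    intro θ
    rw [Finset.sum_mul_sum, Finset.mul_sum]
    refine Finset.sum_congr rfl fun s _ => ?_
    rw [Finset.mul_sum]
    refine Finset.sum_congr rfl fun t _ => ?_
    ring
  simp_rw [h]
  rw [intervalIntegral.integral_finsetSum
    (fun s _ => (continuous_finsetSum _ fun t _ => hterm s t).intervalIntegrable _ _),
    Finset.mul_sum]
  refine Finset.sum_congr rfl fun s _ => ?_
  rw [intervalIntegral.integral_finsetSum
    (fun t _ => (hterm s t).intervalIntegrable _ _), Finset.mul_sum]
  refine Finset.sum_congr rfl fun t _ => ?_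
  rw [intervalIntegral.integral_const_mul, integral_circle_mul_exp hf hρ0 hρ1]
  ring

end PowerSeries

open Complex in
theorem integral_norm_sq_sum_exp {ι : Type*} [Fintype ι] {d : ι → ℕ}
    (hd : Function.Injective d) (x : ι → ℂ) :
    ∫ θ in (0 : ℝ)..2 * Real.pi, ‖∑ s, x s * exp (d s * (θ * I))‖ ^ 2 =
      2 * Real.pi * ∑ s, ‖x s‖ ^ 2 := by
  classical
  have hone : ∀ z : ℂ, ‖z‖ < 1 →
      HasSum (fun n : ℕ => (Pi.single 0 1 : ℕ → ℂ) n * z ^ n) ((fun _ => 1 : ℂ → ℂ) z) := by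
    intro z _
    convert hasSum_single 0 ?_ using 1
    · simp
    · intro n hn
      simp [hn]
  have h := integral_circle_mul_sum_mul_sum hone le_rfl zero_lt_one d d x (fun s => star (x s))
  have hl : ∀ θ : ℝ, (1 : ℂ) * ((∑ s, x s * exp (d s * (θ * I))) *
        ∑ s, star (x s) * exp (-(d s * (θ * I)))) =
      ((‖∑ s, x s * exp (d s * (θ * I))‖ ^ 2 : ℝ) : ℂ) := by
    intro θ
    rw [one_mul, ofReal_pow, ← mul_conj', map_sum]
    congr 1
    refine Finset.sum_congr rfl fun s _ => ?_
    simp [← exp_conj]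
  have hr : ∀ s t, x s * star (x t) * (if d s ≤ d t then
        (Pi.single 0 1 : ℕ → ℂ) (d t - d s) * ((0 : ℝ) : ℂ) ^ (d t - d s) else 0) =
      if s = t then ((‖x s‖ ^ 2 : ℝ) : ℂ) else 0 := by
    intro s t
    by_cases hst : s = t
    · subst hst
      simp [mul_conj']
    · have hne : d s ≠ d t := fun h => hst (hd h)
      rw [if_neg hst]
      split_ifs with hle
      · have : d t - d s ≠ 0 := by omega
        simp [this]
      · simp
  simp_rw [hl, hr] at h
  rw [intervalIntegral.integral_ofReal] at h
  simp only [Finset.sum_ite_eq, Finset.mem_univ, if_true] at h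
  exact_mod_cast h

open Complex in
/-- The lower triangular Toeplitz form of the coefficients of a function bounded by `1` on the unit
disk is contractive. -/
theorem norm_toeplitz_sum_le {f : ℂ → ℂ} {a : ℕ → ℂ}
    (hf : ∀ z : ℂ, ‖z‖ < 1 → HasSum (fun n : ℕ => a n * z ^ n) (f z))
    (hb : ∀ z : ℂ, ‖z‖ < 1 → ‖f z‖ ≤ 1)
    {ι κ : Type*} [Fintype ι] [Fintype κ] {d : ι → ℕ} {e : κ → ℕ}
    (hd : Function.Injective d) (he : Function.Injective e) (x : ι → ℂ) (y : κ → ℂ) :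
    ‖∑ s, ∑ t, x s * y t * if d s ≤ e t then a (e t - d s) else 0‖ ≤
      (∑ s, ‖x s‖ ^ 2 + ∑ t, ‖y t‖ ^ 2) / 2 := by
  have hpi : 0 < 2 * Real.pi := by positivity
  have hρ : ∀ ρ ∈ Set.Ico (0 : ℝ) 1, ‖∑ s, ∑ t, x s * y t *
      if d s ≤ e t then a (e t - d s) * (ρ : ℂ) ^ (e t - d s) else 0‖ ≤
        (∑ s, ‖x s‖ ^ 2 + ∑ t, ‖y t‖ ^ 2) / 2 := by
    rintro ρ ⟨hρ0, hρ1⟩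
    have h := integral_circle_mul_sum_mul_sum hf hρ0 hρ1 d e x y
    have hx := integral_norm_sq_sum_exp hd x
    have hy := integral_norm_sq_sum_exp he (fun t => star (y t))
    simp only [norm_star] at hy
    have hle : ‖∫ θ in (0 : ℝ)..2 * Real.pi, f (ρ * exp (θ * I)) *
          ((∑ s, x s * exp (d s * (θ * I))) * ∑ t, y t * exp (-(e t * (θ * I))))‖ ≤
        ∫ θ in (0 : ℝ)..2 * Real.pi, (‖∑ s, x s * exp (d s * (θ * I))‖ ^ 2 +
          ‖∑ t, star (y t) * exp (e t * (θ * I))‖ ^ 2) / 2 := by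
      refine intervalIntegral.norm_integral_le_of_norm_le hpi.le
        (Filter.Eventually.of_forall fun θ _ => ?_)
        (Continuous.intervalIntegrable (by fun_prop) _ _)
      have hstar : ‖∑ t, y t * exp (-(e t * (θ * I)))‖ =
          ‖∑ t, star (y t) * exp (e t * (θ * I))‖ := by
        rw [← norm_star, star_sum]
        congr 1
        refine Finset.sum_congr rfl fun s _ => ?_
        simp [← exp_conj, mul_comm]
      rw [norm_mul, norm_mul, hstar]
      have h1 := hb (ρ * exp (θ * I)) (by rwa [norm_mul_exp_mul_I hρ0])
      have h2 := mul_le_of_le_one_left (mul_nonneg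
        (norm_nonneg (∑ s, x s * exp (d s * (θ * I))))
        (norm_nonneg (∑ t, star (y t) * exp (e t * (θ * I))))) h1
      linarith [two_mul_le_add_sq ‖∑ s, x s * exp (d s * (θ * I))‖
        ‖∑ t, star (y t) * exp (e t * (θ * I))‖]
    rw [intervalIntegral.integral_div, intervalIntegral.integral_add
      (Continuous.intervalIntegrable (by fun_prop) _ _)
      (Continuous.intervalIntegrable (by fun_prop) _ _), hx, hy, h, norm_mul] at hle
    have hn : ‖(2 * Real.pi : ℂ)‖ = 2 * Real.pi := by
      simp [abs_of_pos Real.pi_pos]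
    rw [hn, ← mul_add, mul_div_assoc] at hle
    exact le_of_mul_le_mul_left hle hpi
  have hcont : Continuous (fun ρ : ℝ => ‖∑ s, ∑ t, x s * y t *
      if d s ≤ e t then a (e t - d s) * (ρ : ℂ) ^ (e t - d s) else 0‖) := by
    refine (continuous_finsetSum _ fun s _ => continuous_finsetSum _ fun t _ => ?_).norm
    split_ifs <;> fun_prop
  have hlim := (hcont.tendsto 1).mono_left (nhdsWithin_le_nhds (s := Set.Iio 1))
  simp only [ofReal_one, one_pow, mul_one] at hlim
  exact le_of_tendsto hlim (Filter.mem_of_superset (Ico_mem_nhdsLT zero_lt_one) hρ)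

section Carlson

variable {f : ℂ → ℂ} {a : ℕ → ℂ}
  (hf : ∀ z : ℂ, ‖z‖ < 1 → HasSum (fun n : ℕ => a n * z ^ n) (f z))
  (hb : ∀ z : ℂ, ‖z‖ < 1 → ‖f z‖ ≤ 1)
include hf hb

open ComplexConjugate

/-- Carlson's inequality for the coefficients of odd index. -/
theorem norm_coeff_odd_le (n : ℕ) :
    ‖a (2 * n + 1)‖ ≤ 1 - ∑ k ∈ Finset.range (n + 1), ‖a k‖ ^ 2 := by
  obtain ⟨ω, hω, hωa⟩ : ∃ ω : ℂ, ‖ω‖ = 1 ∧ (‖a (2 * n + 1)‖ : ℂ) = ω * a (2 * n + 1) :=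
    RCLike.exists_norm_eq_mul_self _
  let d : Option (Fin (n + 1)) → ℕ := fun s => s.elim 0 fun j => 2 * n + 1 - j
  let e : Option (Fin (n + 1)) → ℕ := fun s => s.elim (2 * n + 1) fun j => j
  have hd : Function.Injective d := by
    rintro (_ | j) (_ | k) h <;> simp [d, Fin.ext_iff] at h ⊢ <;> omega
  have he : Function.Injective e := by
    rintro (_ | j) (_ | k) h <;> simp [e, Fin.ext_iff] at h ⊢ <;> omega
  have h := norm_toeplitz_sum_le hf hb hd he
    (fun s => s.elim ω fun j => conj (a j)) (fun s => s.elim 1 fun j => conj (ω * a j))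
  have h1 : ∀ j : Fin (n + 1), 2 * n + 1 - (2 * n + 1 - (j : ℕ)) = j := fun j => by omega
  have h2 : ∀ j k : Fin (n + 1), ¬ (2 * n + 1 - (j : ℕ) ≤ k) := fun j k => by omega
  have hωω : ω * conj ω = 1 := by simp [Complex.mul_conj', hω]
  have h3 : ∀ j : Fin (n + 1), ω * (conj ω * conj (a j)) * a j = ((‖a j‖ ^ 2 : ℝ) : ℂ) := by
    intro j
    rw [Complex.ofReal_pow, ← Complex.mul_conj']
    linear_combination (a j * conj (a j)) * hωω
  have h4 : ∀ j : Fin (n + 1), conj (a j) * a j = ((‖a j‖ ^ 2 : ℝ) : ℂ) := by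
    intro j
    rw [Complex.ofReal_pow, ← Complex.conj_mul']
  simp only [Fintype.sum_option, d, e, Option.elim_none, Option.elim_some, Nat.zero_le, if_true,
    Nat.sub_zero, mul_one, Nat.sub_le, h1, h2, if_false, mul_zero, Finset.sum_const_zero, add_zero,
    map_mul, h3, h4, norm_mul, hω, ← hωa, one_mul, norm_one, RCLike.norm_conj, one_pow,
    Fin.sum_univ_eq_sum_range (fun k => ‖a k‖ ^ 2), ← Complex.ofReal_sum] at h
  rw [← Complex.ofReal_add, ← Complex.ofReal_add, Complex.norm_real] at h
  have := (Real.le_norm_self _).trans h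
  linarith

/-- Carlson's inequality for the coefficients of even index. -/
theorem norm_coeff_even_le {n : ℕ} (hn : n ≠ 0) :
    ‖a (2 * n)‖ ≤
      1 - ∑ k ∈ Finset.range n, ‖a k‖ ^ 2 - ‖a n‖ ^ 2 / (1 + ‖a 0‖) := by
  obtain ⟨ω, hω, hωa⟩ : ∃ ω : ℂ, ‖ω‖ = 1 ∧ (‖a (2 * n)‖ : ℂ) = ω * a (2 * n) :=
    RCLike.exists_norm_eq_mul_self _
  let t : ℝ := 1 / (1 + ‖a 0‖)
  let d : Option (Option (Fin n)) → ℕ := fun s => s.elim 0 fun s => s.elim n fun j => 2 * n - j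
  let e : Option (Option (Fin n)) → ℕ := fun s => s.elim (2 * n) fun s => s.elim n fun j => j
  have hd : Function.Injective d := by
    rintro (_ | _ | j) (_ | _ | k) h <;> simp [d, Fin.ext_iff] at h ⊢ <;> omega
  have he : Function.Injective e := by
    rintro (_ | _ | j) (_ | _ | k) h <;> simp [e, Fin.ext_iff] at h ⊢ <;> omega
  have h := norm_toeplitz_sum_le hf hb hd he
    (fun s => s.elim ω fun s => s.elim (t * conj (a n)) fun j => conj (a j))
    (fun s => s.elim 1 fun s => s.elim (t * conj (ω * a n)) fun j => conj (ω * a j))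
  have h1 : ∀ j : Fin n, 2 * n - (2 * n - (j : ℕ)) = j := fun j => by omega
  have h2 : ∀ j k : Fin n, ¬ (2 * n - (j : ℕ) ≤ k) := fun j k => by omega
  have h2' : ∀ j : Fin n, ¬ (2 * n - (j : ℕ) ≤ n) := fun j => by omega
  have h2'' : ∀ j : Fin n, ¬ (n ≤ j) := fun j => by omega
  have h5 : 2 * n - n = n := by omega
  have h6 : n ≤ 2 * n := by omega
  have hωω : ω * conj ω = 1 := by simp [Complex.mul_conj', hω]
  have h3 : ∀ j : Fin n, ω * (conj ω * conj (a j)) * a j = ((‖a j‖ ^ 2 : ℝ) : ℂ) := by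
    intro j
    rw [Complex.ofReal_pow, ← Complex.mul_conj']
    linear_combination (a j * conj (a j)) * hωω
  have h4 : ∀ j : Fin n, conj (a j) * a j = ((‖a j‖ ^ 2 : ℝ) : ℂ) := by
    intro j
    rw [Complex.ofReal_pow, ← Complex.conj_mul']
  simp only [Fintype.sum_option, d, e, Option.elim_none, Option.elim_some, Nat.zero_le, if_true,
    Nat.sub_zero, mul_one, Nat.sub_le, h1, h2, h2', h2'', h5, h6, if_false, mul_zero,
    Finset.sum_const_zero, add_zero, le_refl, Nat.sub_self,
    map_mul, h3, h4, norm_mul, hω, ← hωa, one_mul, norm_one, RCLike.norm_conj, one_pow,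
    Fin.sum_univ_eq_sum_range (fun k => ‖a k‖ ^ 2), ← Complex.ofReal_sum] at h
  set S := ∑ i ∈ Finset.range n, ‖a i‖ ^ 2
  set W : ℂ := t * conj (a n) * (t * (conj ω * conj (a n))) * a 0 with hW
  have ht : 0 ≤ t := by positivity
  have hWn : ‖W‖ = t ^ 2 * ‖a n‖ ^ 2 * ‖a 0‖ := by
    simp only [hW, norm_mul, RCLike.norm_conj, hω, Complex.norm_real, Real.norm_of_nonneg ht]
    ring
  have han : a n * conj (a n) = ((‖a n‖ ^ 2 : ℝ) : ℂ) := by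
    rw [Complex.ofReal_pow, ← Complex.mul_conj']
  have hsplit : (‖a (2 * n)‖ : ℂ) + (ω * (t * (conj ω * conj (a n))) * a n + (S : ℂ)) +
      (t * conj (a n) * a n + W + (S : ℂ)) =
      ((‖a (2 * n)‖ + 2 * S + 2 * t * ‖a n‖ ^ 2 : ℝ) : ℂ) - -W := by
    push_cast at han ⊢
    linear_combination (t * (a n * conj (a n))) * hωω + 2 * t * han
  rw [hsplit, Complex.norm_real, Real.norm_of_nonneg ht] at h
  have hge := (norm_sub_norm_le _ _).trans h
  rw [norm_neg, hWn, Complex.norm_real] at hge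
  have hself := Real.le_norm_self (‖a (2 * n)‖ + 2 * S + 2 * t * ‖a n‖ ^ 2)
  have hopt : 2 * t * ‖a n‖ ^ 2 - t ^ 2 * ‖a n‖ ^ 2 * ‖a 0‖ - (t * ‖a n‖) ^ 2 =
      ‖a n‖ ^ 2 / (1 + ‖a 0‖) := by
    simp only [t]
    field_simp
    ring
  linarith

end Carlson

/-- If `f(z) = Σ aₙ zⁿ` is analytic in the unit disk with `|f| ≤ 1`, then for
`0 ≤ r ≤ 1/(2+|a₀|)`,
`Σ |aₙ| rⁿ + (1/(1+|a₀|) + r/(1-r)) Σ_{n≥1} |aₙ|² r^{2n} ≤ 1`. -/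
theorem stmt_2 (f : ℂ → ℂ) (a : ℕ → ℂ)
    (hf : ∀ z : ℂ, ‖z‖ < 1 → HasSum (fun n : ℕ => a n * z ^ n) (f z))
    (hb : ∀ z : ℂ, ‖z‖ < 1 → ‖f z‖ ≤ 1)
    (r : ℝ) (hr0 : 0 ≤ r) (hr1 : r ≤ 1 / (2 + ‖a 0‖)) :
    (∑' n : ℕ, ‖a n‖ * r ^ n) +
      (1 / (1 + ‖a 0‖) + r / (1 - r)) *
        ∑' n : ℕ, ‖a (n + 1)‖ ^ 2 * r ^ (2 * (n + 1)) ≤ 1 := by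
  have hα := norm_nonneg (a 0)
  have hr2 : r * (2 + ‖a 0‖) ≤ 1 := by rwa [le_div_iff₀ (by positivity)] at hr1
  have hr : r < 1 := by nlinarith
  have h1r : 0 < 1 - r := by linarith
  set c : ℝ := 1 / (1 + ‖a 0‖) + r / (1 - r) with hc
  have hfin : ∀ M : ℕ, ∑ m ∈ Finset.range (2 * M + 1), ‖a m‖ * r ^ m +
      c * ∑ k ∈ Finset.range M, ‖a (k + 1)‖ ^ 2 * r ^ (2 * (k + 1)) +
      (1 - ∑ k ∈ Finset.range (M + 1), ‖a k‖ ^ 2) * (r ^ (2 * M + 1) / (1 - r)) ≤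
      ‖a 0‖ + (1 - ‖a 0‖ ^ 2) * (r / (1 - r)) := by
    intro M
    induction M with
    | zero => simp
    | succ M ih =>
      refine le_trans ?_ ih
      have h1 := mul_le_mul_of_nonneg_right (norm_coeff_odd_le hf hb M) (pow_nonneg hr0 (2 * M + 1))
      have h2 := mul_le_mul_of_nonneg_right (norm_coeff_even_le hf hb (Nat.succ_ne_zero M))
        (pow_nonneg hr0 (2 * M + 2))
      rw [show 2 * (M + 1) + 1 = 2 * M + 3 by ring, Finset.sum_range_succ _ (2 * M + 2),
        Finset.sum_range_succ _ (2 * M + 1), Finset.sum_range_succ _ M,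
        Finset.sum_range_succ (fun k => ‖a k‖ ^ 2) (M + 1)]
      rw [show 2 * Nat.succ M = 2 * M + 2 from rfl, show Nat.succ M = M + 1 from rfl] at h2
      rw [show 2 * (M + 1) = 2 * M + 2 by ring]
      set D := 1 - ∑ k ∈ Finset.range (M + 1), ‖a k‖ ^ 2 with hD
      have hid : D * r ^ (2 * M + 1) + (D - ‖a (M + 1)‖ ^ 2 / (1 + ‖a 0‖)) * r ^ (2 * M + 2) +
          c * (‖a (M + 1)‖ ^ 2 * r ^ (2 * M + 2)) +
          (D - ‖a (M + 1)‖ ^ 2) * (r ^ (2 * M + 3) / (1 - r)) =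
          D * (r ^ (2 * M + 1) / (1 - r)) := by
        rw [hc]
        field_simp
        ring
      rw [← sub_sub, ← hD, mul_add]
      linarith
  have hnorm : ∀ n, ‖a n‖ ≤ 1 := by
    intro n
    have h1 := norm_coeff_odd_le hf hb n
    have h2 := Finset.single_le_sum (f := fun k => ‖a k‖ ^ 2) (fun k _ => by positivity)
      (Finset.self_mem_range_succ n)
    have h3 := norm_nonneg (a (2 * n + 1))
    nlinarith [norm_nonneg (a n)]
  have hs := summable_norm_coeff_mul_pow hf hr0 hr
  have hs2 : Summable (fun n : ℕ => ‖a (n + 1)‖ ^ 2 * r ^ (2 * (n + 1))) := by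
    refine Summable.of_nonneg_of_le (fun n => by positivity) (fun n => ?_)
      ((summable_nat_add_iff 1).mpr hs)
    have h1 : ‖a (n + 1)‖ * r ^ (n + 1) ≤ 1 :=
      mul_le_one₀ (hnorm _) (by positivity) (pow_le_one₀ hr0 hr.le)
    calc ‖a (n + 1)‖ ^ 2 * r ^ (2 * (n + 1))
        = (‖a (n + 1)‖ * r ^ (n + 1)) * (‖a (n + 1)‖ * r ^ (n + 1)) := by ring
      _ ≤ ‖a (n + 1)‖ * r ^ (n + 1) := mul_le_of_le_one_left (by positivity) h1
  have hodd : Filter.Tendsto (fun M : ℕ => 2 * M + 1) Filter.atTop Filter.atTop :=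
    Filter.tendsto_atTop_mono (g := fun M => 2 * M + 1) (f := fun M => M) (fun M => by omega)
      Filter.tendsto_id
  have hlim := (hs.hasSum.tendsto_sum_nat.comp hodd).add
    (hs2.hasSum.tendsto_sum_nat.const_mul c)
  refine le_of_tendsto' hlim fun M => ?_
  have hrest : 0 ≤ (1 - ∑ k ∈ Finset.range (M + 1), ‖a k‖ ^ 2) * (r ^ (2 * M + 1) / (1 - r)) :=
    mul_nonneg ((norm_nonneg _).trans (norm_coeff_odd_le hf hb M)) (by positivity)
  have hmajor : ‖a 0‖ + (1 - ‖a 0‖ ^ 2) * (r / (1 - r)) ≤ 1 := by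
    have h1 : r / (1 - r) ≤ 1 / (1 + ‖a 0‖) := by
      rw [div_le_div_iff₀ h1r (by positivity)]
      linarith
    have h2 : (1 - ‖a 0‖ ^ 2) * (1 / (1 + ‖a 0‖)) = 1 - ‖a 0‖ := by
      field_simp
      ring
    have h3 := mul_le_mul_of_nonneg_left h1 (show 0 ≤ 1 - ‖a 0‖ ^ 2 by nlinarith [hnorm 0])
    linarith
  have := hfin M
  simp only [Function.comp_apply]
  linarith
end

section
/- If f(z) = Σ_{n=1}^∞ a_n z^n is analytic in the open unit disk 𝔻 with f(0) = 0 and |f(z)| ≤ 1 for all z ∈ 𝔻, then for every r with 0 < r ≤ (5−√17)/2 one has Σ_{n=1}^∞ |a_n| r^n + (r^{−1}/(1+|a_1|) + 1/(1−r)) · Σ_{n=1}^∞ |a_n|² r^{2n} ≤ 1. -/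
open Complex Finset

lemma integral_exp_I_zpow (k : ℤ) :
    ∫ θ in (0 : ℝ)..2 * Real.pi, exp (θ * I) ^ k = if k = 0 then (2 * Real.pi : ℂ) else 0 := by
  split_ifs with hk
  · simp [hk]
  · have h : ∀ θ : ℝ, exp (θ * I) ^ k = exp ((k * I) * θ) := fun θ ↦ by
      rw [← exp_int_mul]; ring_nf
    have hk' : (k : ℂ) * I ≠ 0 := mul_ne_zero (by exact_mod_cast hk) I_ne_zero
    simp_rw [h]
    rw [integral_exp_mul_complex hk']
    have : (k : ℂ) * I * ((2 * Real.pi : ℝ) : ℂ) = k * (2 * Real.pi * I) := by push_cast; ring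
    rw [this, exp_int_mul_two_pi_mul_I]
    simp

lemma continuous_exp_I_zpow (k : ℤ) : Continuous fun θ : ℝ ↦ exp (θ * I) ^ k :=
  Continuous.zpow₀ (by fun_prop) k fun θ ↦ Or.inl (exp_ne_zero _)

lemma norm_exp_I_zpow (θ : ℝ) (k : ℤ) : ‖exp (θ * I) ^ k‖ = 1 := by
  rw [norm_zpow, norm_exp_ofReal_mul_I, one_zpow]

/-- Fourier coefficients of an absolutely convergent power series on the unit circle. -/
lemma integral_mul_exp_I_zpow {c : ℕ → ℂ} (hc : Summable fun n ↦ ‖c n‖) {F : ℝ → ℂ}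
    (hF : ∀ θ : ℝ, HasSum (fun n ↦ c n * exp (θ * I) ^ n) (F θ)) (k : ℤ) :
    ∫ θ in (0 : ℝ)..2 * Real.pi, F θ * exp (θ * I) ^ (-k)
      = 2 * Real.pi * if 0 ≤ k then c k.toNat else 0 := by
  have h := intervalIntegral.hasSum_integral_of_dominated_convergence
    (μ := MeasureTheory.volume) (a := 0) (b := 2 * Real.pi)
    (F := fun n (θ : ℝ) ↦ c n * exp (θ * I) ^ ((n : ℤ) - k))
    (f := fun θ ↦ F θ * exp (θ * I) ^ (-k))
    (fun n _ ↦ ‖c n‖)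
    (fun n ↦ (continuous_const.mul (continuous_exp_I_zpow _)).aestronglyMeasurable)
    (fun n ↦ .of_forall fun θ _ ↦ by rw [norm_mul, norm_exp_I_zpow, mul_one])
    (.of_forall fun θ _ ↦ hc) (by simp)
    (.of_forall fun θ _ ↦ by
      have e : (fun n : ℕ ↦ c n * exp (θ * I) ^ ((n : ℤ) - k))
          = fun n ↦ c n * exp (θ * I) ^ n * exp (θ * I) ^ (-k) := funext fun n ↦ by
        rw [sub_eq_add_neg, zpow_add₀ (exp_ne_zero _), zpow_natCast, mul_assoc]
      exact e ▸ (hF θ).mul_right (exp (θ * I) ^ (-k)))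
  refine h.unique ?_
  simp_rw [intervalIntegral.integral_const_mul, integral_exp_I_zpow]
  split_ifs with hk
  · convert hasSum_single k.toNat ?_ using 1
    · rw [if_pos (by omega)]; ring
    · intro n hn
      rw [if_neg (by omega), mul_zero]
  · convert hasSum_zero using 2 with n
    · rw [if_neg (by omega), mul_zero]
    · simp

lemma integral_norm_sq_sum_exp_I (w : ℕ → ℂ) (N : ℕ) :
    ∫ θ in (0 : ℝ)..2 * Real.pi, ‖∑ i ∈ range N, w i * exp (θ * I) ^ i‖ ^ 2
      = 2 * Real.pi * ∑ i ∈ range N, ‖w i‖ ^ 2 := by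
  apply ofReal_injective
  rw [← intervalIntegral.integral_ofReal]
  have h : ∀ θ : ℝ, ((‖∑ i ∈ range N, w i * exp (θ * I) ^ i‖ ^ 2 : ℝ) : ℂ)
      = ∑ i ∈ range N, ∑ j ∈ range N,
        (w i * (starRingEnd ℂ) (w j)) * exp (θ * I) ^ ((i : ℤ) - j) := fun θ ↦ by
    have he : (starRingEnd ℂ) (exp (θ * I)) = (exp (θ * I))⁻¹ := by
      rw [← exp_conj, ← exp_neg]; simp
    push_cast
    rw [← mul_conj', map_sum, sum_mul_sum]
    refine sum_congr rfl fun i _ ↦ sum_congr rfl fun j _ ↦ ?_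
    rw [map_mul, map_pow, he, zpow_sub₀ (exp_ne_zero _), zpow_natCast, zpow_natCast, inv_pow]
    ring
  have hc : ∀ i j : ℕ, Continuous fun θ : ℝ ↦
      (w i * (starRingEnd ℂ) (w j)) * exp (θ * I) ^ ((i : ℤ) - j) := fun i j ↦
    continuous_const.mul (continuous_exp_I_zpow _)
  simp_rw [h]
  rw [intervalIntegral.integral_finsetSum
    fun i _ ↦ (continuous_finsetSum _ fun j _ ↦ hc i j).intervalIntegrable _ _]
  push_cast
  rw [mul_sum]
  refine sum_congr rfl fun i hi ↦ ?_
  rw [intervalIntegral.integral_finsetSum fun j _ ↦ (hc i j).intervalIntegrable _ _]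
  simp_rw [intervalIntegral.integral_const_mul, integral_exp_I_zpow]
  rw [sum_eq_single_of_mem i hi fun j _ hj ↦ by rw [if_neg (by omega), mul_zero]]
  rw [if_pos (by simp), mul_conj']
  ring

/-- The quadratic form of the Hankel matrix of a power series bounded by `1` on the unit circle
is bounded by `1`. -/
lemma norm_sum_mul_mul_coeff_le {c : ℕ → ℂ} (hc0 : c 0 = 0) (hc : Summable fun n ↦ ‖c n‖)
    {F : ℝ → ℂ} (hF : ∀ θ : ℝ, HasSum (fun n ↦ c n * exp (θ * I) ^ n) (F θ))
    (hF1 : ∀ θ, ‖F θ‖ ≤ 1) (w : ℕ → ℂ) (M N : ℕ) :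
    ‖∑ i ∈ range N, ∑ j ∈ range N, w i * w j * c (M - (i + j))‖
      ≤ ∑ i ∈ range N, ‖w i‖ ^ 2 := by
  have hFc : Continuous F := by
    have : F = fun θ : ℝ ↦ ∑' n, c n * exp (θ * I) ^ n := funext fun θ ↦ (hF θ).tsum_eq.symm
    rw [this]
    refine continuous_tsum (fun n ↦ by fun_prop) hc fun n θ ↦ ?_
    rw [norm_mul, norm_pow, norm_exp_ofReal_mul_I, one_pow, mul_one]
  have hcont : ∀ i j : ℕ, Continuous fun θ : ℝ ↦
      (w i * w j) * (F θ * exp (θ * I) ^ (-((M : ℤ) - (i + j)))) := fun i j ↦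
    continuous_const.mul (hFc.mul (continuous_exp_I_zpow _))
  have h1 : ∀ θ : ℝ, F θ * (∑ i ∈ range N, w i * exp (θ * I) ^ i) ^ 2 * exp (θ * I) ^ (-(M : ℤ))
      = ∑ i ∈ range N, ∑ j ∈ range N,
        (w i * w j) * (F θ * exp (θ * I) ^ (-((M : ℤ) - (i + j)))) := fun θ ↦ by
    rw [sq, sum_mul_sum, mul_sum, sum_mul]
    refine sum_congr rfl fun i _ ↦ ?_
    rw [mul_sum, sum_mul]
    refine sum_congr rfl fun j _ ↦ ?_
    rw [neg_sub, sub_eq_add_neg, zpow_add₀ (exp_ne_zero _), zpow_add₀ (exp_ne_zero _),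
      zpow_natCast, zpow_natCast]
    ring
  have h2 : ∫ θ in (0 : ℝ)..2 * Real.pi,
      F θ * (∑ i ∈ range N, w i * exp (θ * I) ^ i) ^ 2 * exp (θ * I) ^ (-(M : ℤ))
      = 2 * Real.pi * ∑ i ∈ range N, ∑ j ∈ range N, w i * w j * c (M - (i + j)) := by
    simp_rw [h1]
    rw [intervalIntegral.integral_finsetSum fun i _ ↦
      (continuous_finsetSum _ fun j _ ↦ hcont i j).intervalIntegrable _ _,
      mul_sum]
    refine sum_congr rfl fun i _ ↦ ?_
    rw [intervalIntegral.integral_finsetSum fun j _ ↦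
      (hcont i j).intervalIntegrable _ _, mul_sum]
    refine sum_congr rfl fun j _ ↦ ?_
    rw [intervalIntegral.integral_const_mul, integral_mul_exp_I_zpow hc hF]
    have : (if 0 ≤ (M : ℤ) - (i + j) then c ((M : ℤ) - (i + j)).toNat else 0)
        = c (M - (i + j)) := by
      split_ifs with h
      · congr 1; omega
      · rw [show M - (i + j) = 0 by omega, hc0]
    rw [this]; ring
  have h3 := intervalIntegral.norm_integral_le_of_norm_le (μ := MeasureTheory.volume)
    (a := 0) (b := 2 * Real.pi)
    (f := fun θ : ℝ ↦
      F θ * (∑ i ∈ range N, w i * exp (θ * I) ^ i) ^ 2 * exp (θ * I) ^ (-(M : ℤ)))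
    (g := fun θ : ℝ ↦ ‖∑ i ∈ range N, w i * exp (θ * I) ^ i‖ ^ 2)
    (by positivity)
    (.of_forall fun θ _ ↦ by
      rw [norm_mul, norm_mul, norm_exp_I_zpow, mul_one, norm_pow]
      exact mul_le_of_le_one_left (by positivity) (hF1 θ))
    (Continuous.intervalIntegrable (by fun_prop) _ _)
  rw [h2, integral_norm_sq_sum_exp_I, norm_mul] at h3
  have h4 : ‖(2 * Real.pi : ℂ)‖ = 2 * Real.pi := by
    simp [abs_of_pos Real.pi_pos]
  rw [h4] at h3
  exact le_of_mul_le_mul_left h3 (by positivity)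

/-- The Hankel form bound for the coefficients of a function bounded by `1` on the unit disk. -/
lemma norm_sum_mul_mul_coeff_le_of_ball {f : ℂ → ℂ} {a : ℕ → ℂ} (h0 : a 0 = 0)
    (hf : ∀ z : ℂ, ‖z‖ < 1 → HasSum (fun n : ℕ ↦ a n * z ^ n) (f z))
    (hb : ∀ z : ℂ, ‖z‖ < 1 → ‖f z‖ ≤ 1) (w : ℕ → ℂ) (M N : ℕ) :
    ‖∑ i ∈ range N, ∑ j ∈ range N, w i * w j * a (M - (i + j))‖
      ≤ ∑ i ∈ range N, ‖w i‖ ^ 2 := by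
  have key : ∀ ρ ∈ Set.Ioo (0 : ℝ) 1,
      ‖∑ i ∈ range N, ∑ j ∈ range N, w i * w j * (a (M - (i + j)) * (ρ : ℂ) ^ (M - (i + j)))‖
      ≤ ∑ i ∈ range N, ‖w i‖ ^ 2 := fun ρ hρ ↦ by
    have hn : ∀ θ : ℝ, ‖(ρ : ℂ) * exp (θ * I)‖ < 1 := fun θ ↦ by
      rw [norm_mul, norm_exp_ofReal_mul_I, mul_one, norm_real, Real.norm_of_nonneg hρ.1.le]
      exact hρ.2
    have hn' : ‖(ρ : ℂ)‖ < 1 := by simpa using hn 0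
    refine norm_sum_mul_mul_coeff_le (c := fun n ↦ a n * (ρ : ℂ) ^ n)
      (F := fun θ : ℝ ↦ f (ρ * exp (θ * I))) (by simp [h0])
      (hf _ hn').summable.norm (fun θ ↦ ?_) (fun θ ↦ hb _ (hn θ)) w M N
    simpa [mul_pow, mul_assoc] using hf _ (hn θ)
  have hc : Continuous fun ρ : ℝ ↦
      ‖∑ i ∈ range N, ∑ j ∈ range N, w i * w j * (a (M - (i + j)) * (ρ : ℂ) ^ (M - (i + j)))‖ := by
    fun_prop
  have ht := (hc.tendsto 1).mono_left (nhdsWithin_le_nhds (s := Set.Iio 1))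
  have := le_of_tendsto ht
    (Filter.eventually_of_mem (Ioo_mem_nhdsLT (zero_lt_one' ℝ)) key)
  simpa using this

lemma exists_norm_eq_one_mul_eq_norm (c : ℂ) : ∃ u : ℂ, ‖u‖ = 1 ∧ u * c = ‖c‖ := by
  rcases eq_or_ne c 0 with rfl | hc
  · exact ⟨1, by simp⟩
  · have hn : (‖c‖ : ℂ) ≠ 0 := by simpa using hc
    refine ⟨(‖c‖ : ℂ) / c, ?_, by field_simp⟩
    rw [norm_div, norm_real, norm_norm, div_self (by simpa using hc)]

lemma sum_range_succ_mul_mul (w A : ℕ → ℂ) (N : ℕ) :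
    ∑ i ∈ range (N + 1), ∑ j ∈ range (N + 1), w i * w j * A (i + j)
      = w 0 ^ 2 * A 0 + 2 * w 0 * ∑ j ∈ range N, w (j + 1) * A (j + 1)
        + ∑ i ∈ range N, ∑ j ∈ range N, w (i + 1) * w (j + 1) * A (i + j + 2) := by
  simp_rw [sum_range_succ', sum_add_distrib, mul_sum]
  have h1 : ∀ i j, i + 1 + (j + 1) = i + j + 2 := fun i j ↦ by ring
  simp only [h1, add_zero, zero_add]
  have h2 : ∑ i ∈ range N, 2 * w 0 * (w (i + 1) * A (i + 1))
      = ∑ i ∈ range N, w (i + 1) * w 0 * A (i + 1)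
        + ∑ i ∈ range N, w 0 * w (i + 1) * A (i + 1) := by
    rw [← sum_add_distrib]
    exact sum_congr rfl fun i _ ↦ by ring
  rw [h2]
  ring

/-- The Hankel form bound at vectors with first entry `1`. -/
lemma norm_coeff_add_sum_le {f : ℂ → ℂ} {a : ℕ → ℂ} (h0 : a 0 = 0)
    (hf : ∀ z : ℂ, ‖z‖ < 1 → HasSum (fun n : ℕ ↦ a n * z ^ n) (f z))
    (hb : ∀ z : ℂ, ‖z‖ < 1 → ‖f z‖ ≤ 1) (v : ℕ → ℂ) (M N : ℕ) :
    ‖a M + 2 * ∑ j ∈ range N, v j * a (M - (j + 1))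
      + ∑ i ∈ range N, ∑ j ∈ range N, v i * v j * a (M - (i + j + 2))‖
      ≤ ∑ i ∈ range N, ‖v i‖ ^ 2 + 1 := by
  have key := norm_sum_mul_mul_coeff_le_of_ball h0 hf hb
    (fun i ↦ if i = 0 then 1 else v (i - 1)) M (N + 1)
  rw [sum_range_succ_mul_mul _ (fun i ↦ a (M - i)), sum_range_succ' (fun i ↦ ‖_‖ ^ 2)] at key
  simpa using key

section Carlson

variable {f : ℂ → ℂ} {a : ℕ → ℂ}

/-- Carlson's inequality for the coefficients of even index of `f z / z`. -/
lemma carlson_even (h0 : a 0 = 0)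
    (hf : ∀ z : ℂ, ‖z‖ < 1 → HasSum (fun n : ℕ ↦ a n * z ^ n) (f z))
    (hb : ∀ z : ℂ, ‖z‖ < 1 → ‖f z‖ ≤ 1) (m : ℕ) :
    ‖a (2 * m + 3)‖ + ∑ k ∈ range (m + 1), ‖a (k + 1)‖ ^ 2 + ‖a (m + 2)‖ ^ 2 / (1 + ‖a 1‖) ≤ 1 := by
  obtain ⟨u, hu, huc⟩ := exists_norm_eq_one_mul_eq_norm (a (2 * m + 3))
  set Q := ‖a 1‖ with hQ
  have hQ0 : 0 ≤ Q := norm_nonneg _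
  set t : ℂ := (starRingEnd ℂ) (u * a (m + 2)) / ((1 + Q : ℝ) : ℂ) with ht
  set v : ℕ → ℂ := fun j ↦ if j < m then 0 else if j = m then t else
    (starRingEnd ℂ) (u * a (2 * m + 2 - j)) with hv
  have v1 : ∀ j < m, v j = 0 := fun j hj ↦ by simp [hv, hj]
  have v2 : v m = t := by simp [hv]
  have v3 : ∀ k, v (m + 1 + k) = (starRingEnd ℂ) (u * a (m + 1 - k)) := fun k ↦ by
    simp only [hv]
    rw [if_neg (by omega), if_neg (by omega)]
    congr 3; omega
  have split : ∀ {E : Type} [AddCommMonoid E] (g : ℕ → E), (∀ j < m, g j = 0) →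
      ∑ j ∈ range (2 * m + 2), g j = g m + ∑ k ∈ range (m + 1), g (m + 1 + k) := fun g hg ↦ by
    rw [show 2 * m + 2 = (m + 1) + (m + 1) by ring, sum_range_add, sum_range_succ,
      sum_eq_zero fun j hj ↦ hg j (mem_range.mp hj), zero_add]
  have key := norm_coeff_add_sum_le h0 hf hb v (2 * m + 3) (2 * m + 2)
  have quad : ∑ i ∈ range (2 * m + 2), ∑ j ∈ range (2 * m + 2),
      v i * v j * a (2 * m + 3 - (i + j + 2)) = t ^ 2 * a 1 := by
    rw [split _ fun i hi ↦ by simp [v1 i hi], split _ fun i hi ↦ by simp [v1 i hi],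
      sum_eq_zero, sum_eq_zero, v2, show 2 * m + 3 - (m + m + 2) = 1 by omega]
    · ring
    · intro i _
      rw [split _ fun i hi ↦ by simp [v1 i hi], sum_eq_zero]
      · rw [show 2 * m + 3 - (m + 1 + i + m + 2) = 0 by omega, h0]; simp
      · intro j _
        rw [show 2 * m + 3 - (m + 1 + i + (m + 1 + j) + 2) = 0 by omega, h0]; simp
    · intro j _
      rw [show 2 * m + 3 - (m + (m + 1 + j) + 2) = 0 by omega, h0]; simp
  set σ := ∑ k ∈ range (m + 1), ‖a (k + 1)‖ ^ 2 with hσ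
  set X := ‖a (m + 2)‖ ^ 2 with hX
  have hrefl : ∑ k ∈ range (m + 1), ‖a (m + 1 - k)‖ ^ 2 = σ := by
    rw [hσ, ← sum_range_reflect]
    refine sum_congr rfl fun k hk ↦ ?_
    rw [mem_range] at hk
    rw [show m + 1 - (m + 1 - 1 - k) = k + 1 by omega]
  have lin : u * ∑ j ∈ range (2 * m + 2), v j * a (2 * m + 3 - (j + 1))
      = ((X / (1 + Q) + σ : ℝ) : ℂ) := by
    rw [split _ fun i hi ↦ by simp [v1 i hi], v2, show 2 * m + 3 - (m + 1) = m + 2 by omega,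
      mul_add, mul_sum, ofReal_add, ← hrefl, ofReal_sum]
    congr 1
    · have : u * (t * a (m + 2)) = (starRingEnd ℂ) (u * a (m + 2)) * (u * a (m + 2))
          / ((1 + Q : ℝ) : ℂ) := by rw [ht]; ring
      rw [this, conj_mul', norm_mul, hu, one_mul]
      push_cast [hX]; rfl
    · refine sum_congr rfl fun k _ ↦ ?_
      rw [v3, show 2 * m + 3 - (m + 1 + k + 1) = m + 1 - k by omega, mul_left_comm, conj_mul',
        norm_mul, hu, one_mul]
      push_cast; rfl
  have ht2 : ‖t‖ ^ 2 = X / (1 + Q) ^ 2 := by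
    rw [ht, norm_div, RCLike.norm_conj, norm_mul, hu, one_mul, norm_real,
      Real.norm_of_nonneg (by positivity), div_pow]
  have nrm : ∑ j ∈ range (2 * m + 2), ‖v j‖ ^ 2 = X / (1 + Q) ^ 2 + σ := by
    rw [split _ fun i hi ↦ by simp [v1 i hi], v2, ht2, ← hrefl]
    congr 1
    refine sum_congr rfl fun k _ ↦ ?_
    rw [v3, RCLike.norm_conj, norm_mul, hu, one_mul]
  rw [nrm, quad] at key
  have hre : u * (a (2 * m + 3) + 2 * ∑ j ∈ range (2 * m + 2), v j * a (2 * m + 3 - (j + 1))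
      + t ^ 2 * a 1) = ((‖a (2 * m + 3)‖ + 2 * (X / (1 + Q) + σ) : ℝ) : ℂ) + u * (t ^ 2 * a 1) := by
    rw [mul_add, mul_add, huc, mul_left_comm, lin]; push_cast; ring
  have h1 := re_le_norm (u * (a (2 * m + 3)
    + 2 * ∑ j ∈ range (2 * m + 2), v j * a (2 * m + 3 - (j + 1)) + t ^ 2 * a 1))
  rw [norm_mul, hu, one_mul, hre, add_re, ofReal_re] at h1
  have h2 := (abs_le.mp (abs_re_le_norm (u * (t ^ 2 * a 1)))).1
  rw [norm_mul, hu, one_mul, norm_mul, norm_pow, ht2, ← hQ] at h2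
  have h3 : X / (1 + Q) = X / (1 + Q) ^ 2 + X / (1 + Q) ^ 2 * Q := by field_simp
  linarith

/-- Carlson's inequality for the coefficients of odd index of `f z / z`. -/
lemma carlson_odd (h0 : a 0 = 0)
    (hf : ∀ z : ℂ, ‖z‖ < 1 → HasSum (fun n : ℕ ↦ a n * z ^ n) (f z))
    (hb : ∀ z : ℂ, ‖z‖ < 1 → ‖f z‖ ≤ 1) (m : ℕ) :
    ‖a (2 * m + 2)‖ + ∑ k ∈ range (m + 1), ‖a (k + 1)‖ ^ 2 ≤ 1 := by
  obtain ⟨u, hu, huc⟩ := exists_norm_eq_one_mul_eq_norm (a (2 * m + 2))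
  set v : ℕ → ℂ := fun j ↦ if j < m then 0 else
    (starRingEnd ℂ) (u * a (2 * m + 1 - j)) with hv
  have v1 : ∀ j < m, v j = 0 := fun j hj ↦ by simp [hv, hj]
  have v3 : ∀ k, v (m + k) = (starRingEnd ℂ) (u * a (m + 1 - k)) := fun k ↦ by
    simp only [hv]
    rw [if_neg (by omega)]
    congr 3; omega
  have split : ∀ {E : Type} [AddCommMonoid E] (g : ℕ → E), (∀ j < m, g j = 0) →
      ∑ j ∈ range (2 * m + 1), g j = ∑ k ∈ range (m + 1), g (m + k) := fun g hg ↦ by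
    rw [show 2 * m + 1 = m + (m + 1) by ring, sum_range_add,
      sum_eq_zero fun j hj ↦ hg j (mem_range.mp hj), zero_add]
  have key := norm_coeff_add_sum_le h0 hf hb v (2 * m + 2) (2 * m + 1)
  have quad : ∑ i ∈ range (2 * m + 1), ∑ j ∈ range (2 * m + 1),
      v i * v j * a (2 * m + 2 - (i + j + 2)) = 0 := by
    rw [split _ fun i hi ↦ by simp [v1 i hi]]
    refine sum_eq_zero fun i _ ↦ ?_
    rw [split _ fun i hi ↦ by simp [v1 i hi]]
    refine sum_eq_zero fun j _ ↦ ?_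
    rw [show 2 * m + 2 - (m + i + (m + j) + 2) = 0 by omega, h0, mul_zero]
  set σ := ∑ k ∈ range (m + 1), ‖a (k + 1)‖ ^ 2 with hσ
  have hrefl : ∑ k ∈ range (m + 1), ‖a (m + 1 - k)‖ ^ 2 = σ := by
    rw [hσ, ← sum_range_reflect]
    refine sum_congr rfl fun k hk ↦ ?_
    rw [mem_range] at hk
    rw [show m + 1 - (m + 1 - 1 - k) = k + 1 by omega]
  have lin : u * ∑ j ∈ range (2 * m + 1), v j * a (2 * m + 2 - (j + 1)) = (σ : ℂ) := by
    rw [split _ fun i hi ↦ by simp [v1 i hi], mul_sum, ← hrefl, ofReal_sum]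
    refine sum_congr rfl fun k _ ↦ ?_
    rw [v3, show 2 * m + 2 - (m + k + 1) = m + 1 - k by omega, mul_left_comm, conj_mul',
      norm_mul, hu, one_mul]
    push_cast; rfl
  have nrm : ∑ j ∈ range (2 * m + 1), ‖v j‖ ^ 2 = σ := by
    rw [split _ fun i hi ↦ by simp [v1 i hi], ← hrefl]
    refine sum_congr rfl fun k _ ↦ ?_
    rw [v3, RCLike.norm_conj, norm_mul, hu, one_mul]
  rw [nrm, quad, add_zero] at key
  have hre : u * (a (2 * m + 2) + 2 * ∑ j ∈ range (2 * m + 1), v j * a (2 * m + 2 - (j + 1)))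
      = ((‖a (2 * m + 2)‖ + 2 * σ : ℝ) : ℂ) := by
    rw [mul_add, huc, mul_left_comm, lin]; push_cast; ring
  have h1 := re_le_norm (u * (a (2 * m + 2)
    + 2 * ∑ j ∈ range (2 * m + 1), v j * a (2 * m + 2 - (j + 1))))
  rw [norm_mul, hu, one_mul, hre, ofReal_re] at h1
  linarith

end Carlson

/-- The refined Bohr inequality for the partial sums, derived from Carlson's inequalities. -/
lemma refined_bohr_partial {x : ℕ → ℝ} (hx : ∀ n, 0 ≤ x n)
    (hodd : ∀ m, x (2 * m + 1) + ∑ k ∈ range (m + 1), x k ^ 2 ≤ 1)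
    (heven : ∀ m, x (2 * m + 2) + ∑ k ∈ range (m + 1), x k ^ 2 + x (m + 1) ^ 2 / (1 + x 0) ≤ 1)
    {r : ℝ} (hr0 : 0 < r) (hr1 : r < 1) (M : ℕ) :
    ∑ n ∈ range (2 * M + 1), x n * r ^ n
      + (1 / (1 + x 0) + r / (1 - r)) * ∑ n ∈ range (M + 1), x n ^ 2 * r ^ (2 * n)
      ≤ x 0 + x 0 ^ 2 / (1 + x 0) + r / (1 - r) := by
  have hd : 0 < 1 - r := by linarith
  have hx0 : 0 < 1 + x 0 := by linarith [hx 0]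
  have key : ∑ n ∈ range (2 * M + 1), x n * r ^ n
      + (1 / (1 + x 0) + r / (1 - r)) * ∑ n ∈ range (M + 1), x n ^ 2 * r ^ (2 * n)
      ≤ x 0 + x 0 ^ 2 / (1 + x 0) + r / (1 - r)
        - r / (1 - r) * r ^ (2 * M) * (1 - ∑ k ∈ range (M + 1), x k ^ 2) := by
    induction M with
    | zero =>
      simp only [mul_zero, zero_add, sum_range_one, pow_zero, mul_one]
      apply le_of_eq; ring
    | succ M ih =>
      have e : 2 * (M + 1) + 1 = 2 * M + 1 + 1 + 1 := by ring
      rw [e, sum_range_succ _ (2 * M + 1 + 1), sum_range_succ _ (2 * M + 1),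
        sum_range_succ (fun n ↦ x n ^ 2 * r ^ (2 * n)) (M + 1),
        sum_range_succ (fun n ↦ x n ^ 2) (M + 1)]
      set S := ∑ k ∈ range (M + 1), x k ^ 2
      have h1 : x (2 * M + 1) * r ^ (2 * M + 1) ≤ (1 - S) * r ^ (2 * M + 1) :=
        mul_le_mul_of_nonneg_right (by linarith [hodd M]) (by positivity)
      have h2 : x (2 * M + 1 + 1) * r ^ (2 * M + 1 + 1)
          ≤ (1 - S - x (M + 1) ^ 2 / (1 + x 0)) * r ^ (2 * M + 1 + 1) :=
        mul_le_mul_of_nonneg_right (by linarith [heven M]) (by positivity)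
      have h3 : (1 - S) * r ^ (2 * M + 1) + (1 - S) * r ^ (2 * M + 1 + 1)
          = r / (1 - r) * r ^ (2 * M) * (1 - S) - r / (1 - r) * r ^ (2 * (M + 1)) * (1 - S) := by
        field_simp; ring
      have h4 : 2 * M + 1 + 1 = 2 * (M + 1) := by ring
      rw [h4] at h2 h3 ⊢
      have h5 : (1 / (1 + x 0)) * (x (M + 1) ^ 2 * r ^ (2 * (M + 1)))
          = x (M + 1) ^ 2 / (1 + x 0) * r ^ (2 * (M + 1)) := by ring
      rw [mul_add (_ + _), add_mul (1 / (1 + x 0)) _ (x (M + 1) ^ 2 * _), h5]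
      linarith
  have hS : 0 ≤ 1 - ∑ k ∈ range (M + 1), x k ^ 2 := by linarith [hodd M, hx (2 * M + 1)]
  have : 0 ≤ r / (1 - r) * r ^ (2 * M) * (1 - ∑ k ∈ range (M + 1), x k ^ 2) := by positivity
  linarith

lemma mul_add_div_le_one {r x : ℝ} (hr0 : 0 < r) (hr1 : r ≤ (5 - Real.sqrt 17) / 2)
    (hx0 : 0 ≤ x) (hx1 : x ≤ 1) : r * (x + x ^ 2 / (1 + x) + r / (1 - r)) ≤ 1 := by
  have hs : Real.sqrt 17 ^ 2 = 17 := Real.sq_sqrt (by norm_num)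
  have hs4 : 4 < Real.sqrt 17 := Real.lt_sqrt_of_sq_lt (by norm_num)
  have hd : 0 < 1 - r := by linarith
  have hq : 0 ≤ r ^ 2 - 5 * r + 2 := by nlinarith
  have h1 : x + x ^ 2 / (1 + x) ≤ 3 / 2 := by
    have : x ^ 2 / (1 + x) ≤ x / 2 := by
      rw [div_le_div_iff₀ (by linarith) (by norm_num)]; nlinarith
    linarith
  have h2 : r * (3 / 2 + r / (1 - r)) ≤ 1 := by
    rw [show r * (3 / 2 + r / (1 - r)) = (3 * r - r ^ 2) / (2 * (1 - r)) by field_simp; ring,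
      div_le_one (by positivity)]
    linarith
  exact (mul_le_mul_of_nonneg_left (by linarith) hr0.le).trans h2

/-- Theorem 3(b): if `f(z) = Σ_{n≥1} aₙ zⁿ` is analytic in the unit disk with `f(0) = 0` and
`|f| ≤ 1`, then for `0 < r ≤ (5-√17)/2`,
`Σ_{n≥1} |aₙ| rⁿ + (r⁻¹/(1+|a₁|) + 1/(1-r)) Σ_{n≥1} |aₙ|² r^{2n} ≤ 1`. -/
theorem stmt_8 (f : ℂ → ℂ) (a : ℕ → ℂ) (h0 : a 0 = 0)
    (hf : ∀ z : ℂ, ‖z‖ < 1 → HasSum (fun n : ℕ => a n * z ^ n) (f z))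
    (hb : ∀ z : ℂ, ‖z‖ < 1 → ‖f z‖ ≤ 1)
    (r : ℝ) (hr0 : 0 < r) (hr1 : r ≤ (5 - Real.sqrt 17) / 2) :
    (∑' n : ℕ, ‖a (n + 1)‖ * r ^ (n + 1)) +
      (r⁻¹ / (1 + ‖a 1‖) + 1 / (1 - r)) *
        ∑' n : ℕ, ‖a (n + 1)‖ ^ 2 * r ^ (2 * (n + 1)) ≤ 1 := by
  have hs4 : 4 < Real.sqrt 17 := Real.lt_sqrt_of_sq_lt (by norm_num)
  have hr : r < 1 := by linarith
  have hodd := carlson_odd h0 hf hb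
  have hsum : Summable fun n ↦ ‖a (n + 1)‖ * r ^ (n + 1) := by
    have h := (hf r (by rwa [norm_real, Real.norm_of_nonneg hr0.le])).summable.norm
    simp_rw [norm_mul, norm_pow, norm_real, Real.norm_of_nonneg hr0.le] at h
    exact (summable_nat_add_iff 1).mpr h
  have ha1 : ∀ n, ‖a (n + 1)‖ ^ 2 ≤ 1 := fun n ↦
    (single_le_sum (f := fun k ↦ ‖a (k + 1)‖ ^ 2) (fun _ _ ↦ sq_nonneg _)
      (self_mem_range_succ n)).trans (by linarith [hodd n, norm_nonneg (a (2 * n + 2))])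
  have hsum2 : Summable fun n ↦ ‖a (n + 1)‖ ^ 2 * r ^ (2 * (n + 1)) := by
    refine .of_nonneg_of_le (fun n ↦ by positivity) (fun n ↦ ?_)
      ((summable_nat_add_iff 1).mpr
        (summable_geometric_of_lt_one (sq_nonneg r) (by nlinarith : r ^ 2 < 1)))
    rw [pow_mul]
    exact mul_le_of_le_one_left (by positivity) (ha1 n)
  have t1 := hsum.hasSum.tendsto_sum_nat.comp
    (Filter.tendsto_atTop_mono (fun M : ℕ ↦ (by omega : M ≤ 2 * M + 1)) Filter.tendsto_id)
  have t2 := (hsum2.hasSum.tendsto_sum_nat.comp (Filter.tendsto_add_atTop_nat 1)).const_mul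
    (r⁻¹ / (1 + ‖a 1‖) + 1 / (1 - r))
  refine le_of_tendsto' (t1.add t2) fun M ↦ ?_
  have h := refined_bohr_partial (x := fun n ↦ ‖a (n + 1)‖) (fun n ↦ norm_nonneg _)
    hodd (carlson_even h0 hf hb) hr0 hr M
  refine le_trans ?_ ((mul_le_mul_of_nonneg_left h hr0.le).trans
    (mul_add_div_le_one hr0 hr1 (norm_nonneg _)
      ((sq_le_one_iff₀ (norm_nonneg _)).mp (ha1 0))))
  have e1 : ∑ n ∈ range (2 * M + 1), ‖a (n + 1)‖ * r ^ (n + 1)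
      = r * ∑ n ∈ range (2 * M + 1), ‖a (n + 1)‖ * r ^ n := by
    rw [mul_sum]; exact sum_congr rfl fun n _ ↦ by ring
  have e2 : ∑ n ∈ range (M + 1), ‖a (n + 1)‖ ^ 2 * r ^ (2 * (n + 1))
      = r ^ 2 * ∑ n ∈ range (M + 1), ‖a (n + 1)‖ ^ 2 * r ^ (2 * n) := by
    rw [mul_sum]; exact sum_congr rfl fun n _ ↦ by ring
  have hd : 1 - r ≠ 0 := by linarith
  have hx : 1 + ‖a 1‖ ≠ 0 := by positivity
  simp only [Function.comp_apply, e1, e2, zero_add]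
  apply le_of_eq
  field_simp
end
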